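/- For each integer k ≥ 1 there is a constant C(k) > 0 such that for every prime power q and all integers m ≥ 1 and n ≥ 2mk, one has |Poly_q(n,m;k) − c(m,k)| ≤ C(k)·c(m,k)/q; in particular, for q ≥ 2C(k), Poly_q(n,m;k) is bounded above and below by positive constants (depending only on k) times 1 + m^{2^{2k−1}−2k−1}. -/

import Mathlib

open scoped Classical

/-- `permTupleCount m k` (= `c(m,k)`) is the number of tuples `(r_I)` indexed by the
subsets `I` of `{1,…,2k}` (normalized by `r ∅ = 0`) of non-negative integers such that
`r_I ∈ {0,1}` whenever `#I` is odd, and `∑_{I ∋ i} r_I = m` for each `i`. -/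
noncomputable def permTupleCount (m k : ℕ) : ℕ :=
  Nat.card {r : Finset (Fin (2 * k)) → ℕ //
    r ∅ = 0 ∧
    (∀ I : Finset (Fin (2 * k)), Odd I.card → r I ≤ 1) ∧
    (∀ i : Fin (2 * k),
      ∑ I ∈ Finset.univ.filter (fun I : Finset (Fin (2 * k)) => i ∈ I), r I = m)}

/-- The Möbius function of a polynomial over a finite field: `μ(M) = (−1)^ℓ` if `M` is
squarefree with `ℓ` monic irreducible factors, and `μ(M) = 0` otherwise. -/
noncomputable def polyMu {Fq : Type*} [Field Fq] (M : Polynomial Fq) : ℤ :=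
  if Squarefree M then
    (-1) ^ (Nat.card {P : Polynomial Fq // P.Monic ∧ Irreducible P ∧ P ∣ M})
  else 0

/-- `Poly_q(n,m;k) := q^{−n} Σ_{N monic, deg N = n}
  (Σ_{M monic, M ∣ N, deg M = m} μ(M))^{2k}`. -/
noncomputable def polyMoment (Fq : Type*) [Field Fq] [Fintype Fq] (n m k : ℕ) : ℝ :=
  ((Fintype.card Fq : ℝ) ^ n)⁻¹ *
    ∑ᶠ N ∈ {N : Polynomial Fq | N.Monic ∧ N.natDegree = n},
      (∑ᶠ M ∈ {M : Polynomial Fq | M.Monic ∧ M ∣ N ∧ M.natDegree = m},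
        (polyMu M : ℝ)) ^ (2 * k)

section MonicPolynomials

open Polynomial UniqueFactorizationMonoid

variable (F : Type*) [Field F] [Fintype F]

lemma finite_monic_natDegree_eq (n : ℕ) : {p : F[X] | p.Monic ∧ p.natDegree = n}.Finite :=
  (((monicEquivDegreeLT n).trans (degreeLTEquiv F n).toEquiv).finite_iff.mpr inferInstance :
    Finite {p : F[X] // p.Monic ∧ p.natDegree = n})

/-- The monic polynomials of degree `n` over a finite field. -/
noncomputable def monicsOfDegree (n : ℕ) : Finset F[X] := (finite_monic_natDegree_eq F n).toFinset

/-- The monic irreducible polynomials of degree at most `m` over a finite field. -/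
noncomputable def monicIrreducibles (m : ℕ) : Finset F[X] :=
  ((Finset.Icc 1 m).biUnion (monicsOfDegree F)).filter Irreducible

variable {F}

@[simp]
lemma mem_monicsOfDegree {n : ℕ} {p : F[X]} :
    p ∈ monicsOfDegree F n ↔ p.Monic ∧ p.natDegree = n := by
  simp [monicsOfDegree]

lemma mem_monicIrreducibles {m : ℕ} {p : F[X]} :
    p ∈ monicIrreducibles F m ↔ p.Monic ∧ Irreducible p ∧ p.natDegree ≤ m := by
  simp only [monicIrreducibles, Finset.mem_filter, Finset.mem_biUnion, Finset.mem_Icc,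
    mem_monicsOfDegree]
  constructor
  · rintro ⟨⟨a, ⟨_, h⟩, hp, rfl⟩, hi⟩
    exact ⟨hp, hi, h⟩
  · rintro ⟨hp, hi, h⟩
    exact ⟨⟨_, ⟨hi.natDegree_pos, h⟩, hp, rfl⟩, hi⟩

variable (F) in
lemma card_monicsOfDegree (n : ℕ) : (monicsOfDegree F n).card = Fintype.card F ^ n := by
  have h : Nat.card {p : F[X] // p.Monic ∧ p.natDegree = n} = Fintype.card F ^ n := by
    rw [Nat.card_congr ((monicEquivDegreeLT n).trans (degreeLTEquiv F n).toEquiv)]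
    simp
  rw [← h, monicsOfDegree, ← Set.ncard_eq_toFinset_card _ (finite_monic_natDegree_eq F n)]
  rfl

lemma card_monicsOfDegree_filter_dvd {n : ℕ} {D : F[X]} (hD : D.Monic) :
    ((monicsOfDegree F n).filter (D ∣ ·)).card =
      if D.natDegree ≤ n then Fintype.card F ^ (n - D.natDegree) else 0 := by
  split_ifs with h
  · rw [← card_monicsOfDegree]
    symm
    refine Finset.card_bij (fun M _ => D * M) ?_ ?_ ?_
    · intro M hM
      rw [mem_monicsOfDegree] at hM
      simp only [Finset.mem_filter, mem_monicsOfDegree, dvd_mul_right, and_true]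
      refine ⟨hD.mul hM.1, ?_⟩
      rw [hD.natDegree_mul hM.1, hM.2]
      omega
    · intro M _ M' _ e
      exact mul_left_cancel₀ hD.ne_zero e
    · intro N hN
      simp only [Finset.mem_filter, mem_monicsOfDegree] at hN
      obtain ⟨⟨hN, hd⟩, M, rfl⟩ := hN
      have hM : M.Monic := hD.of_mul_monic_left hN
      refine ⟨M, ?_, rfl⟩
      rw [hD.natDegree_mul hM] at hd
      rw [mem_monicsOfDegree]
      exact ⟨hM, by omega⟩
  · rw [Finset.card_eq_zero, Finset.filter_eq_empty_iff]
    intro N hN hdvd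
    rw [mem_monicsOfDegree] at hN
    have := natDegree_le_of_dvd hdvd hN.1.ne_zero
    omega

variable {m : ℕ} {T : Finset F[X]}

lemma prod_dvd_iff_of_subset_monicIrreducibles (hT : T ⊆ monicIrreducibles F m) (N : F[X]) :
    ∏ P ∈ T, P ∣ N ↔ ∀ P ∈ T, P ∣ N := by
  refine ⟨fun h P hP => (Finset.dvd_prod_of_mem (fun P => P) hP).trans h, fun h => ?_⟩
  refine Finset.prod_dvd_of_isRelPrime ?_ h
  intro P hP Q hQ hne
  have hP' := mem_monicIrreducibles.mp (hT hP)
  have hQ' := mem_monicIrreducibles.mp (hT hQ)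
  refine (hP'.2.1.isRelPrime_iff_not_dvd).mpr fun hd => hne ?_
  exact eq_of_monic_of_associated hP'.1 hQ'.1 (hP'.2.1.associated_of_dvd hQ'.2.1 hd)

lemma monic_prod_of_subset_monicIrreducibles (hT : T ⊆ monicIrreducibles F m) :
    (∏ P ∈ T, P).Monic :=
  monic_prod_of_monic _ _ fun _ hP => (mem_monicIrreducibles.mp (hT hP)).1

lemma natDegree_prod_of_subset_monicIrreducibles (hT : T ⊆ monicIrreducibles F m) :
    (∏ P ∈ T, P).natDegree = ∑ P ∈ T, P.natDegree :=
  natDegree_prod_of_monic _ _ fun _ hP => (mem_monicIrreducibles.mp (hT hP)).1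

lemma dvd_prod_iff_of_subset_monicIrreducibles (hT : T ⊆ monicIrreducibles F m) {P : F[X]}
    (hP : P.Monic) (hi : Irreducible P) : P ∣ ∏ Q ∈ T, Q ↔ P ∈ T := by
  refine ⟨fun h => ?_, fun h => Finset.dvd_prod_of_mem (fun P => P) h⟩
  obtain ⟨Q, hQ, hd⟩ := (hi.prime.dvd_finsetProd_iff _).mp h
  have hQ' := mem_monicIrreducibles.mp (hT hQ)
  rwa [eq_of_monic_of_associated hP hQ'.1 (hi.associated_of_dvd hQ'.2.1 hd)]

lemma squarefree_prod_of_subset_monicIrreducibles (hT : T ⊆ monicIrreducibles F m) :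
    Squarefree (∏ P ∈ T, P) := by
  refine Finset.squarefree_prod_of_pairwise_isCoprime ?_ fun P hP =>
    (mem_monicIrreducibles.mp (hT hP)).2.1.squarefree
  intro P hP Q hQ hne
  have hP' := mem_monicIrreducibles.mp (hT hP)
  have hQ' := mem_monicIrreducibles.mp (hT hQ)
  refine (hP'.2.1.isRelPrime_iff_not_dvd).mpr fun hd => hne ?_
  exact eq_of_monic_of_associated hP'.1 hQ'.1 (hP'.2.1.associated_of_dvd hQ'.2.1 hd)

lemma polyMu_prod_of_subset_monicIrreducibles (hT : T ⊆ monicIrreducibles F m) :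
    polyMu (∏ P ∈ T, P) = (-1) ^ T.card := by
  rw [polyMu, if_pos (squarefree_prod_of_subset_monicIrreducibles hT)]
  congr 1
  rw [← Nat.card_eq_finsetCard T]
  refine Nat.card_congr (Equiv.subtypeEquivRight fun P => ?_)
  constructor
  · rintro ⟨hP, hi, hd⟩
    exact (dvd_prod_iff_of_subset_monicIrreducibles hT hP hi).mp hd
  · intro hP
    have hP' := mem_monicIrreducibles.mp (hT hP)
    exact ⟨hP'.1, hP'.2.1, Finset.dvd_prod_of_mem (fun P => P) hP⟩

lemma exists_prod_eq_of_squarefree {M : F[X]} (hM : M.Monic) (hs : Squarefree M)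
    (hd : M.natDegree ≤ m) : ∃ T ⊆ monicIrreducibles F m, ∏ P ∈ T, P = M := by
  refine ⟨primeFactors M, fun P hP => ?_, ?_⟩
  · rw [mem_primeFactors] at hP
    have hi := irreducible_of_normalized_factor P hP
    rw [mem_monicIrreducibles]
    refine ⟨?_, hi, (natDegree_le_of_dvd (dvd_of_mem_normalizedFactors hP) hM.ne_zero).trans hd⟩
    rw [← normalize_normalized_factor P hP]
    exact monic_normalize hi.ne_zero
  · have := radical_associated hs.isRadical hM.ne_zero
    refine eq_of_monic_of_associated ?_ hM this
    refine monic_prod_of_monic _ _ fun P hP => ?_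
    rw [mem_primeFactors] at hP
    rw [← normalize_normalized_factor P hP]
    exact monic_normalize (irreducible_of_normalized_factor P hP).ne_zero

/-- The sum of `μ(M)` over the monic divisors `M` of `N` of degree `m`, as a sum over sets of
irreducible polynomials. -/
lemma finsum_polyMu_eq (N : F[X]) (m : ℕ) :
    (∑ᶠ M ∈ {M : F[X] | M.Monic ∧ M ∣ N ∧ M.natDegree = m}, (polyMu M : ℝ)) =
      ∑ T ∈ (monicIrreducibles F m).powerset.filter
        (fun T => (∀ P ∈ T, P ∣ N) ∧ ∑ P ∈ T, P.natDegree = m), (-1 : ℝ) ^ T.card := by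
  have h : (∑ᶠ M ∈ {M : F[X] | M.Monic ∧ M ∣ N ∧ M.natDegree = m}, (polyMu M : ℝ)) =
      ∑ M ∈ (monicsOfDegree F m).filter (fun M => M ∣ N ∧ Squarefree M), (polyMu M : ℝ) := by
    refine finsum_mem_eq_sum_of_inter_support_eq _ ?_
    ext M
    simp only [Set.mem_inter_iff, Set.mem_ofPred_eq, Function.mem_support, Finset.coe_filter,
      mem_monicsOfDegree]
    constructor
    · rintro ⟨⟨h1, h2, h3⟩, h4⟩
      refine ⟨⟨⟨h1, h3⟩, h2, ?_⟩, h4⟩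
      by_contra hs
      simp [polyMu, hs] at h4
    · tauto
  rw [h]
  symm
  refine Finset.sum_bij (fun T _ => ∏ P ∈ T, P) ?_ ?_ ?_ ?_
  · intro T hT
    simp only [Finset.mem_filter, Finset.mem_powerset] at hT
    simp only [Finset.mem_filter, mem_monicsOfDegree]
    exact ⟨⟨monic_prod_of_subset_monicIrreducibles hT.1,
      (natDegree_prod_of_subset_monicIrreducibles hT.1).trans hT.2.2⟩,
      (prod_dvd_iff_of_subset_monicIrreducibles hT.1 N).mpr hT.2.1,
      squarefree_prod_of_subset_monicIrreducibles hT.1⟩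
  · intro T hT T' hT' e
    simp only [Finset.mem_filter, Finset.mem_powerset] at hT hT'
    ext P
    constructor
    · intro hP
      have hP' := mem_monicIrreducibles.mp (hT.1 hP)
      rw [← dvd_prod_iff_of_subset_monicIrreducibles hT'.1 hP'.1 hP'.2.1, ← e]
      exact Finset.dvd_prod_of_mem (fun P => P) hP
    · intro hP
      have hP' := mem_monicIrreducibles.mp (hT'.1 hP)
      rw [← dvd_prod_iff_of_subset_monicIrreducibles hT.1 hP'.1 hP'.2.1, e]
      exact Finset.dvd_prod_of_mem (fun P => P) hP
  · intro M hM
    simp only [Finset.mem_filter, mem_monicsOfDegree] at hM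
    obtain ⟨T, hT, rfl⟩ := exists_prod_eq_of_squarefree hM.1.1 hM.2.2 hM.1.2.le
    refine ⟨T, ?_, rfl⟩
    simp only [Finset.mem_filter, Finset.mem_powerset]
    exact ⟨hT, (prod_dvd_iff_of_subset_monicIrreducibles hT N).mp hM.2.1,
      (natDegree_prod_of_subset_monicIrreducibles hT).symm.trans hM.1.2⟩
  · intro T hT
    simp only [Finset.mem_filter, Finset.mem_powerset] at hT
    rw [polyMu_prod_of_subset_monicIrreducibles hT.1]
    simp

/-- The number of monic polynomials of degree `n` divisible by all elements of a set of
irreducible polynomials. -/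
lemma card_filter_forall_dvd (hT : T ⊆ monicIrreducibles F m) (n : ℕ) :
    (((monicsOfDegree F n).filter (fun N => ∀ P ∈ T, P ∣ N)).card : ℝ) =
      if ∑ P ∈ T, P.natDegree ≤ n then
        (Fintype.card F : ℝ) ^ n * ∏ P ∈ T, ((Fintype.card F : ℝ) ^ P.natDegree)⁻¹ else 0 := by
  have h := card_monicsOfDegree_filter_dvd (n := n) (monic_prod_of_subset_monicIrreducibles hT)
  simp only [prod_dvd_iff_of_subset_monicIrreducibles hT,
    natDegree_prod_of_subset_monicIrreducibles hT] at h
  rw [h]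
  split_ifs with hle
  · have hq : (Fintype.card F : ℝ) ≠ 0 := by simp
    push_cast
    rw [pow_sub₀ _ hq hle, Finset.prod_inv_distrib, Finset.prod_pow_eq_pow_sum]
  · simp

/-- Inclusion-exclusion over the irreducible polynomials of degree at most `m`: every monic
polynomial of degree `1 ≤ n ≤ m` has an irreducible factor. -/
lemma sum_powerset_monicIrreducibles_eq (m n : ℕ) (hn : n ≤ m) :
    ∑ T ∈ (monicIrreducibles F m).powerset.filter (fun T => ∑ P ∈ T, P.natDegree ≤ n),
      ∏ P ∈ T, (-((Fintype.card F : ℝ) ^ P.natDegree)⁻¹) = if n = 0 then 1 else 0 := by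
  have hq : (Fintype.card F : ℝ) ≠ 0 := by simp
  have key : ∑ N ∈ monicsOfDegree F n, ∏ P ∈ monicIrreducibles F m,
      (1 + if P ∣ N then (-1 : ℝ) else 0) = if n = 0 then 1 else 0 := by
    split_ifs with h0
    · subst h0
      have h1 : monicsOfDegree F 0 = {1} := by
        ext p
        rw [mem_monicsOfDegree, Finset.mem_singleton]
        exact ⟨fun h => h.1.natDegree_eq_zero.mp h.2, fun h => by simp [h]⟩
      rw [h1, Finset.sum_singleton]
      refine Finset.prod_eq_one fun P hP => ?_
      rw [if_neg, add_zero]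
      intro hd
      exact (mem_monicIrreducibles.mp hP).2.1.not_isUnit (isUnit_of_dvd_one hd)
    · refine Finset.sum_eq_zero fun N hN => ?_
      rw [mem_monicsOfDegree] at hN
      have hnu : ¬ IsUnit N := by
        intro hu
        have := natDegree_eq_zero_of_isUnit hu
        omega
      obtain ⟨P, hP, hi, hd⟩ := exists_monic_irreducible_factor N hnu |>.imp fun P h =>
        (⟨h.1, h.2.1, h.2.2⟩ : P.Monic ∧ Irreducible P ∧ P ∣ N)
      refine Finset.prod_eq_zero (i := P) (mem_monicIrreducibles.mpr ⟨hP, hi, ?_⟩) (by simp [hd])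
      have := natDegree_le_of_dvd hd hN.1.ne_zero
      omega
  simp_rw [Finset.prod_one_add] at key
  rw [Finset.sum_comm] at key
  rw [Finset.sum_filter]
  have hqn : (Fintype.card F : ℝ) ^ n ≠ 0 := pow_ne_zero _ hq
  have : ((Fintype.card F : ℝ) ^ n) * (∑ T ∈ (monicIrreducibles F m).powerset,
      if ∑ P ∈ T, P.natDegree ≤ n then ∏ P ∈ T, (-((Fintype.card F : ℝ) ^ P.natDegree)⁻¹) else 0)
      = if n = 0 then 1 else 0 := by
    rw [← key, Finset.mul_sum]
    refine Finset.sum_congr rfl fun T hT => ?_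
    rw [Finset.mem_powerset] at hT
    simp_rw [Finset.prod_ite_zero, Finset.prod_const]
    rw [← Finset.sum_filter, Finset.sum_const, nsmul_eq_mul, card_filter_forall_dvd hT]
    simp_rw [neg_eq_neg_one_mul (_⁻¹ : ℝ), Finset.prod_mul_distrib, Finset.prod_const]
    split_ifs
    · ring
    · simp
  split_ifs at this ⊢ with h0
  · subst h0
    simpa using this
  · exact (mul_eq_zero.mp this).resolve_left hqn

variable (F) in
/-- The reciprocals of the squared norms of the irreducible polynomials have a small sum. -/
lemma sum_monicIrreducibles_inv_sq_le (m : ℕ) :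
    ∑ P ∈ monicIrreducibles F m, (((Fintype.card F : ℝ) ^ P.natDegree)⁻¹) ^ 2 ≤
      2 / (Fintype.card F : ℝ) := by
  have hq : (2 : ℝ) ≤ Fintype.card F := by exact_mod_cast Fintype.one_lt_card (α := F)
  set q : ℝ := (Fintype.card F : ℝ) with hqdef
  have hpos : 0 < q := by linarith
  calc ∑ P ∈ monicIrreducibles F m, ((q ^ P.natDegree)⁻¹) ^ 2
      ≤ ∑ P ∈ (Finset.Icc 1 m).biUnion (monicsOfDegree F), ((q ^ P.natDegree)⁻¹) ^ 2 :=
        Finset.sum_le_sum_of_subset_of_nonneg (Finset.filter_subset _ _) fun _ _ _ => sq_nonneg _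
    _ ≤ ∑ d ∈ Finset.Icc 1 m, ∑ P ∈ monicsOfDegree F d, ((q ^ P.natDegree)⁻¹) ^ 2 := by
        rw [Finset.sum_biUnion]
        intro a _ b _ hab
        rw [Function.onFun, Finset.disjoint_left]
        intro P hP hP'
        rw [mem_monicsOfDegree] at hP hP'
        exact hab (hP.2.symm.trans hP'.2)
    _ = ∑ d ∈ Finset.Icc 1 m, (q⁻¹) ^ d := by
        refine Finset.sum_congr rfl fun d _ => ?_
        rw [Finset.sum_congr rfl (g := fun _ => ((q ^ d)⁻¹) ^ 2) fun P hP => by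
          rw [(mem_monicsOfDegree.mp hP).2]]
        rw [Finset.sum_const, card_monicsOfDegree, nsmul_eq_mul]
        push_cast
        rw [← hqdef]
        simp only [inv_pow]
        field_simp
    _ = q⁻¹ * ∑ d ∈ Finset.range m, (q⁻¹) ^ d := by
        rw [Finset.mul_sum, Finset.range_eq_Ico, ← Finset.Ico_succ_right_eq_Icc,
          Finset.sum_Ico_eq_sum_range, Finset.sum_Ico_eq_sum_range]
        refine Finset.sum_congr (by simp) fun d _ => ?_
        rw [pow_add]; simp
    _ ≤ q⁻¹ * 2 := by
        gcongr
        have h1 : q⁻¹ ≤ 1 / 2 := by rw [inv_le_comm₀ hpos (by norm_num)]; simpa using hq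
        calc ∑ d ∈ Finset.range m, (q⁻¹) ^ d ≤ ∑ d ∈ Finset.range m, (1 / 2 : ℝ) ^ d := by
              gcongr
          _ ≤ 2 := sum_geometric_two_le m
    _ = 2 / q := by ring

end MonicPolynomials

section GeneratingFunction

open MvPolynomial

variable {s : ℕ}

/-- The exponent vector all of whose entries are `m`. -/
noncomputable def constExponent (s m : ℕ) : Fin s →₀ ℕ := Finsupp.equivFunOnFinite.symm fun _ => m

@[simp]
lemma constExponent_apply (m : ℕ) (i : Fin s) : constExponent s m i = m := rfl

/-- The exponent vector of the squarefree monomial `∏ i ∈ I, X i`. -/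
noncomputable def indicatorExponent (I : Finset (Fin s)) : Fin s →₀ ℕ :=
  Finsupp.equivFunOnFinite.symm fun i => if i ∈ I then 1 else 0

@[simp]
lemma indicatorExponent_apply (I : Finset (Fin s)) (i : Fin s) :
    indicatorExponent I i = if i ∈ I then 1 else 0 := rfl

lemma coeff_prod_sum_X_pow {A : Type*} (t : Finset A) (c : A → ℝ) (e : A → ℕ) (m : ℕ) :
    coeff (constExponent s m)
      (∏ i : Fin s, ∑ a ∈ t, (C (c a) * X i ^ e a : MvPolynomial (Fin s) ℝ)) =
      (∑ a ∈ t.filter (fun a => e a = m), c a) ^ s := by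
  simp_rw [C_mul_X_pow_eq_monomial]
  rw [Finset.prod_univ_sum, Finset.sum_pow', coeff_sum]
  simp_rw [← monomial_sum_prod, coeff_monomial]
  rw [← Finset.sum_filter]
  refine Finset.sum_congr ?_ fun _ _ => rfl
  ext x
  simp only [Finset.mem_filter, Fintype.mem_piFinset]
  have : (∑ i, Finsupp.single i (e (x i)) = constExponent s m) ↔ ∀ i, e (x i) = m := by
    rw [DFunLike.ext_iff]
    refine forall_congr' fun i => ?_
    simp [Finsupp.finsetSum_apply, Finsupp.single_apply]
  rw [this]
  exact forall_and.symm

lemma prod_one_sub_X_pow (d : ℕ) :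
    ∏ i : Fin s, (1 - X i ^ d : MvPolynomial (Fin s) ℝ) =
      ∑ I : Finset (Fin s), (-1) ^ I.card * monomial (d • indicatorExponent I) 1 := by
  simp_rw [sub_eq_add_neg]
  rw [Finset.prod_one_add, Finset.powerset_univ]
  refine Finset.sum_congr rfl fun I _ => ?_
  simp_rw [neg_eq_neg_one_mul (X _ ^ d : MvPolynomial (Fin s) ℝ)]
  rw [Finset.prod_mul_distrib, Finset.prod_const]
  congr 1
  simp_rw [X_pow_eq_monomial]
  have h : ∑ i ∈ I, Finsupp.single i d = d • indicatorExponent I := by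
    ext i
    simp [Finsupp.finsetSum_apply, Finsupp.single_apply]
  rw [← monomial_sum_one, h]

lemma prod_one_sub_X_pow_sub_one_mem (d : ℕ) :
    ∏ i : Fin s, (1 - X i ^ d : MvPolynomial (Fin s) ℝ) - 1 ∈ idealOfVars (Fin s) ℝ ^ d := by
  rw [← Ideal.Quotient.eq, map_prod, map_one]
  refine Finset.prod_eq_one fun i _ => ?_
  have : Ideal.Quotient.mk (idealOfVars (Fin s) ℝ ^ d) (X i ^ d) = 0 :=
    Ideal.Quotient.eq_zero_iff_mem.mpr
      (Ideal.pow_mem_pow (Ideal.subset_span (Set.mem_range_self i)) d)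
  rw [map_sub, map_one, this, sub_zero]

lemma finsum_polyMu_pow_eq_coeff {F : Type*} [Field F] [Fintype F] (N : Polynomial F) (m : ℕ) :
    (∑ᶠ M ∈ {M : Polynomial F | M.Monic ∧ M ∣ N ∧ M.natDegree = m}, (polyMu M : ℝ)) ^ s =
      coeff (constExponent s m) (∏ P ∈ monicIrreducibles F m,
        (1 + if P ∣ N then ∏ i : Fin s, (1 - X i ^ P.natDegree : MvPolynomial (Fin s) ℝ) - 1
          else 0)) := by
  have h := coeff_prod_sum_X_pow (s := s)
    ((monicIrreducibles F m).powerset.filter fun T => ∀ P ∈ T, P ∣ N)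
    (fun T => (-1 : ℝ) ^ T.card) (fun T => ∑ P ∈ T, P.natDegree) m
  rw [Finset.filter_filter] at h
  rw [finsum_polyMu_eq, ← h]
  congr 1
  have h1 : ∀ i : Fin s, ∑ T ∈ (monicIrreducibles F m).powerset.filter (fun T => ∀ P ∈ T, P ∣ N),
      (C ((-1 : ℝ) ^ T.card) * X i ^ (∑ P ∈ T, P.natDegree) : MvPolynomial (Fin s) ℝ) =
      ∏ P ∈ monicIrreducibles F m, (1 + if P ∣ N then - X i ^ P.natDegree else 0) := by
    intro i
    rw [Finset.prod_one_add, Finset.sum_filter]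
    refine Finset.sum_congr rfl fun T _ => ?_
    rw [Finset.prod_ite_zero]
    simp_rw [neg_eq_neg_one_mul (X _ ^ _ : MvPolynomial (Fin s) ℝ)]
    rw [Finset.prod_mul_distrib, Finset.prod_const, Finset.prod_pow_eq_pow_sum]
    simp
  simp_rw [h1]
  rw [Finset.prod_comm]
  refine Finset.prod_congr rfl fun P _ => ?_
  split_ifs
  · simp [sub_eq_add_neg]
  · simp

/-- The moments of the truncated divisor sums are coefficients of an Euler product. -/
lemma polyMoment_eq_coeff (F : Type*) [Field F] [Fintype F] {n m k : ℕ} (h : 2 * m * k ≤ n) :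
    polyMoment F n m k = coeff (constExponent (2 * k) m) (∏ P ∈ monicIrreducibles F m,
      (1 + C ((Fintype.card F : ℝ) ^ P.natDegree)⁻¹ *
        (∏ i : Fin (2 * k), (1 - X i ^ P.natDegree : MvPolynomial (Fin (2 * k)) ℝ) - 1))) := by
  have hq : (Fintype.card F : ℝ) ≠ 0 := by simp
  have hqn : (Fintype.card F : ℝ) ^ n ≠ 0 := pow_ne_zero _ hq
  rw [polyMoment, ← Set.Finite.coe_toFinset (finite_monic_natDegree_eq F n), finsum_mem_coe_finset]
  change _ * ∑ N ∈ monicsOfDegree F n, _ = _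
  simp_rw [finsum_polyMu_pow_eq_coeff]
  rw [← coeff_sum, inv_mul_eq_iff_eq_mul₀ hqn]
  simp_rw [Finset.prod_one_add]
  rw [Finset.sum_comm, coeff_sum, coeff_sum, Finset.mul_sum]
  refine Finset.sum_congr rfl fun T hT => ?_
  rw [Finset.mem_powerset] at hT
  simp_rw [Finset.prod_ite_zero]
  rw [← Finset.sum_filter, Finset.sum_const, coeff_smul, nsmul_eq_mul, card_filter_forall_dvd hT,
    Finset.prod_mul_distrib, ← map_prod, coeff_C_mul]
  split_ifs with hle
  · ring
  · rw [zero_mul, eq_comm]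
    have hmem : ∏ P ∈ T, (∏ i : Fin (2 * k),
        (1 - X i ^ P.natDegree : MvPolynomial (Fin (2 * k)) ℝ) - 1) ∈
        idealOfVars (Fin (2 * k)) ℝ ^ (∑ P ∈ T, P.natDegree) := by
      rw [← Finset.prod_pow_eq_pow_sum]
      exact Ideal.prod_mem_prod fun P _ => prod_one_sub_X_pow_sub_one_mem _
    rw [(mem_pow_idealOfVars_iff' _ _).mp hmem, mul_zero, mul_zero]
    have : (constExponent (2 * k) m).degree = 2 * k * m := by
      rw [Finsupp.degree_eq_sum]; simp
    rw [this]
    calc 2 * k * m = 2 * m * k := by ring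
      _ ≤ n := h
      _ < _ := not_le.mp hle

/-- The Euler product of `1 - t` over the irreducible polynomials of degree at most `m`,
with `t` a monomial. -/
lemma coeff_prod_one_sub_monomial (F : Type*) [Field F] [Fintype F] {m : ℕ}
    {α β : Fin s →₀ ℕ} (hα : α ≠ 0) (hβ : β ≤ constExponent s m) :
    coeff β (∏ P ∈ monicIrreducibles F m,
      (1 - monomial (P.natDegree • α) ((Fintype.card F : ℝ) ^ P.natDegree)⁻¹)) =
      coeff β (1 - monomial α (1 : ℝ)) := by
  obtain ⟨i, hi⟩ : ∃ i, α i ≠ 0 := by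
    by_contra! h
    exact hα (Finsupp.ext h)
  have hi' : 0 < α i := Nat.pos_of_ne_zero hi
  set e : ℕ → ℝ := fun j => ∑ T ∈ (monicIrreducibles F m).powerset.filter
    (fun T => ∑ P ∈ T, P.natDegree = j), ∏ P ∈ T, (-((Fintype.card F : ℝ) ^ P.natDegree)⁻¹)
    with he
  have hsum : ∀ j ≤ m, ∑ l ∈ Finset.range (j + 1), e l = if j = 0 then 1 else 0 := by
    intro j hj
    rw [← sum_powerset_monicIrreducibles_eq (F := F) m j hj, he]
    rw [← Finset.sum_fiberwise_of_maps_to (t := Finset.range (j + 1))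
      (g := fun T : Finset (Polynomial F) => ∑ P ∈ T, P.natDegree)]
    · refine Finset.sum_congr rfl fun l hl => ?_
      refine Finset.sum_congr ?_ fun _ _ => rfl
      ext T
      simp only [Finset.mem_filter, Finset.mem_range] at hl ⊢
      constructor
      · rintro ⟨h1, h2⟩
        exact ⟨⟨h1, by omega⟩, h2⟩
      · rintro ⟨⟨h1, _⟩, h2⟩
        exact ⟨h1, h2⟩
    · intro T hT
      simp only [Finset.mem_filter, Finset.mem_range] at hT ⊢
      omega
  have hej : ∀ j ≤ m, e j = if j = 0 then 1 else if j = 1 then -1 else 0 := by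
    intro j hj
    rcases j with _ | j
    · simpa using hsum 0 hj
    · have h1 := hsum (j + 1) hj
      have h2 := hsum j (by omega)
      rw [Finset.sum_range_succ, h2] at h1
      rcases j with _ | j
      · simp at h1 ⊢; linarith
      · simpa using h1
  have hcoeff : coeff β (∏ P ∈ monicIrreducibles F m,
      (1 - monomial (P.natDegree • α) ((Fintype.card F : ℝ) ^ P.natDegree)⁻¹)) =
      ∑ T ∈ (monicIrreducibles F m).powerset, if (∑ P ∈ T, P.natDegree) • α = β then
        ∏ P ∈ T, (-((Fintype.card F : ℝ) ^ P.natDegree)⁻¹) else 0 := by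
    simp_rw [sub_eq_add_neg, ← map_neg]
    rw [Finset.prod_one_add, coeff_sum]
    refine Finset.sum_congr rfl fun T _ => ?_
    rw [← monomial_sum_prod, coeff_monomial, ← Finset.sum_smul]
  rw [hcoeff, coeff_sub, coeff_one, coeff_monomial]
  by_cases hj : ∃ j : ℕ, j • α = β
  · obtain ⟨j, rfl⟩ := hj
    have hinj : ∀ l : ℕ, l • α = j • α ↔ l = j := by
      intro l
      refine ⟨fun h => ?_, fun h => by rw [h]⟩
      have := DFunLike.congr_fun h i
      simpa [hi] using this
    have hjm : j ≤ m := by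
      have := hβ i
      simp only [Finsupp.smul_apply, smul_eq_mul, constExponent_apply] at this
      nlinarith
    simp_rw [hinj]
    rw [← Finset.sum_filter]
    change e j = _
    rw [hej j hjm]
    have h0 : (0 = j • α) ↔ j = 0 := by have := hinj 0; rw [zero_smul] at this; rw [this, eq_comm]
    have h1 : (α = j • α) ↔ j = 1 := by have := hinj 1; rw [one_smul] at this; rw [this, eq_comm]
    simp only [h0, h1]
    split_ifs <;> simp_all
  · push Not at hj
    have h0 : (0 : Fin s →₀ ℕ) ≠ β := by simpa using hj 0
    have h1 : α ≠ β := by simpa using hj 1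
    simp [hj, h0, h1]

end GeneratingFunction

section Seminorm

variable {A : Type*} [CommRing A] (N : RingSeminorm A)

lemma RingSeminorm.map_prod_one_add_sub_one_le {ι : Type*} (t : Finset ι) (a : ι → A)
    (h1 : N 1 ≤ 1) : N (∏ i ∈ t, (1 + a i) - 1) ≤ ∏ i ∈ t, (1 + N (a i)) - 1 := by
  induction t using Finset.induction_on with
  | empty => simp
  | insert i t hi ih =>
    rw [Finset.prod_insert hi, Finset.prod_insert hi]
    have e : (1 + a i) * ∏ j ∈ t, (1 + a j) - 1 =
        (1 + a i) * (∏ j ∈ t, (1 + a j) - 1) + a i := by ring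
    have h2 : N (1 + a i) ≤ 1 + N (a i) := (map_add_le_add N _ _).trans (by gcongr)
    have h3 : 0 ≤ N (a i) := apply_nonneg N _
    calc _ ≤ N ((1 + a i) * (∏ j ∈ t, (1 + a j) - 1)) + N (a i) := by
          rw [e]; exact map_add_le_add N _ _
      _ ≤ N (1 + a i) * N (∏ j ∈ t, (1 + a j) - 1) + N (a i) := by
          gcongr; exact map_mul_le_mul N _ _
      _ ≤ (1 + N (a i)) * (∏ j ∈ t, (1 + N (a j)) - 1) + N (a i) := by
          gcongr
      _ = _ := by ring

lemma RingSeminorm.map_geom_sum_le (h1 : N 1 ≤ 1) {y : A} (hy : N y ≤ 1 / 2) (m : ℕ) :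
    N (∑ r ∈ Finset.range m, y ^ r) ≤ 2 := by
  induction m with
  | zero => simp
  | succ m ih =>
    rw [Finset.sum_range_succ', pow_zero]
    simp_rw [pow_succ']
    rw [← Finset.mul_sum]
    have h3 : 0 ≤ N (∑ r ∈ Finset.range m, y ^ r) := apply_nonneg N _
    calc _ ≤ N (y * ∑ r ∈ Finset.range m, y ^ r) + N 1 := map_add_le_add N _ _
      _ ≤ N y * N (∑ r ∈ Finset.range m, y ^ r) + 1 := by gcongr; exact map_mul_le_mul N _ _
      _ ≤ 1 / 2 * 2 + 1 := by gcongr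
      _ = 2 := by norm_num

lemma RingSeminorm.map_prod_sub_one_add_sum_le {κ : Type*} (t : Finset κ) (v z : κ → A) {δ : ℝ}
    (h1 : N 1 ≤ 1) (h0 : 0 ≤ δ) (hδ : δ ≤ 1 / 2) (hz : ∀ i ∈ t, N (z i) ≤ δ)
    (hv : ∀ i ∈ t, N (v i - 1 + z i) ≤ 2 * δ ^ 2) :
    N (∏ i ∈ t, v i - 1 + ∑ i ∈ t, z i) ≤ 10 ^ t.card * δ ^ 2 := by
  induction t using Finset.induction_on with
  | empty => simp; positivity
  | insert i t hi ih =>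
    rw [Finset.prod_insert hi, Finset.sum_insert hi, Finset.card_insert_of_notMem hi]
    have hE := ih (fun j hj => hz j (Finset.mem_insert_of_mem hj))
      (fun j hj => hv j (Finset.mem_insert_of_mem hj))
    have hzi := hz i (Finset.mem_insert_self i t)
    have hvi := hv i (Finset.mem_insert_self i t)
    have hL : N (∑ j ∈ t, z j) ≤ t.card * δ := by
      refine (Finset.le_sum_of_subadditive N (map_zero N).le (map_add_le_add N) t z).trans ?_
      rw [← nsmul_eq_mul]
      exact Finset.sum_le_card_nsmul _ _ _ fun j hj => hz j (Finset.mem_insert_of_mem hj)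
    set E := ∏ j ∈ t, v j - 1 + ∑ j ∈ t, z j with hEdef
    set L := ∑ j ∈ t, z j
    have hp : ∏ j ∈ t, v j = 1 - L + E := by rw [hEdef]; ring
    have e : v i * ∏ j ∈ t, v j - 1 + (z i + L) =
        (v i * E + z i * L) + (v i - 1 + z i) * (1 - L) := by rw [hp]; ring
    have hv' : N (v i) ≤ 2 := by
      have e' : v i = (v i - 1 + z i) + 1 + (- z i) := by ring
      calc N (v i) = N ((v i - 1 + z i) + 1 + (- z i)) := by rw [← e']
        _ ≤ N (v i - 1 + z i) + N 1 + N (-z i) :=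
          (map_add_le_add N _ _).trans (add_le_add (map_add_le_add N _ _) le_rfl)
        _ ≤ 2 * δ ^ 2 + 1 + δ := by rw [map_neg_eq_map]; gcongr
        _ ≤ 2 := by nlinarith
    have hL' : N (1 - L) ≤ 1 + t.card * δ := (map_sub_le_add N _ _).trans (by gcongr)
    have hn : (t.card : ℝ) ≤ 10 ^ t.card := by exact_mod_cast (Nat.lt_pow_self (by norm_num)).le
    have h10 : (1 : ℝ) ≤ 10 ^ t.card := one_le_pow₀ (by norm_num)
    calc _ ≤ N (v i * E) + N (z i * L) + N ((v i - 1 + z i) * (1 - L)) := by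
          rw [e]
          exact (map_add_le_add N _ _).trans (add_le_add (map_add_le_add N _ _) le_rfl)
      _ ≤ N (v i) * N E + N (z i) * N L + N (v i - 1 + z i) * N (1 - L) := by
          gcongr <;> exact map_mul_le_mul N _ _
      _ ≤ 2 * (10 ^ t.card * δ ^ 2) + δ * (t.card * δ) + 2 * δ ^ 2 * (1 + t.card * δ) := by
          gcongr
      _ ≤ 2 * (10 ^ t.card * δ ^ 2) + δ * (10 ^ t.card * δ) +
          2 * δ ^ 2 * (10 ^ t.card + 10 ^ t.card * (1 / 2)) := by gcongr
      _ ≤ 10 ^ (t.card + 1) * δ ^ 2 := by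
          have hX := mul_nonneg (zero_le_one.trans h10) (sq_nonneg δ)
          rw [pow_succ 10]
          linarith

lemma RingSeminorm.map_one_add_sum_mul_prod_sub_one_le {κ : Type*} (t : Finset κ) (v z : κ → A)
    {δ : ℝ} (h1 : N 1 ≤ 1) (h0 : 0 ≤ δ) (hδ : δ ≤ 1 / 2) (hz : ∀ i ∈ t, N (z i) ≤ δ)
    (hv : ∀ i ∈ t, N (v i - 1 + z i) ≤ 2 * δ ^ 2) :
    N ((1 + ∑ i ∈ t, z i) * ∏ i ∈ t, v i - 1) ≤
      ((t.card : ℝ) ^ 2 + (1 + t.card) * 10 ^ t.card) * δ ^ 2 := by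
  have hE := N.map_prod_sub_one_add_sum_le t v z h1 h0 hδ hz hv
  have hL : N (∑ j ∈ t, z j) ≤ t.card * δ := by
    refine (Finset.le_sum_of_subadditive N (map_zero N).le (map_add_le_add N) t z).trans ?_
    rw [← nsmul_eq_mul]
    exact Finset.sum_le_card_nsmul _ _ _ hz
  set E := ∏ j ∈ t, v j - 1 + ∑ j ∈ t, z j with hEdef
  set L := ∑ j ∈ t, z j
  have hp : ∏ j ∈ t, v j = 1 - L + E := by rw [hEdef]; ring
  have e : (1 + L) * ∏ j ∈ t, v j - 1 = -(L * L) + (1 + L) * E := by rw [hp]; ring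
  have hL1 : N (1 + L) ≤ 1 + t.card * δ := (map_add_le_add N _ _).trans (by gcongr)
  have hc : (0 : ℝ) ≤ t.card := Nat.cast_nonneg _
  have hd : (0 : ℝ) ≤ 10 ^ t.card := by positivity
  generalize (t.card : ℝ) = c at *
  generalize (10 : ℝ) ^ t.card = p at *
  calc _ ≤ N (-(L * L)) + N ((1 + L) * E) := by rw [e]; exact map_add_le_add N _ _
    _ ≤ N L * N L + N (1 + L) * N E := by
        rw [map_neg_eq_map]; gcongr <;> exact map_mul_le_mul N _ _
    _ ≤ (c * δ) * (c * δ) + (1 + c * δ) * (p * δ ^ 2) := by gcongr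
    _ ≤ (c * δ) * (c * δ) + (1 + c * 1) * (p * δ ^ 2) := by
        gcongr; linarith
    _ = _ := by ring

/-- The ideal of elements of seminorm zero. -/
def RingSeminorm.nullIdeal : Ideal A where
  carrier := {a | N a = 0}
  add_mem' {a b} ha hb := by
    have ha' : N a = 0 := ha
    have hb' : N b = 0 := hb
    have h := map_add_le_add N a b
    rw [ha', hb', add_zero] at h
    exact le_antisymm h (apply_nonneg N _)
  zero_mem' := map_zero N
  smul_mem' c a ha := by
    have ha' : N a = 0 := ha
    have h := map_mul_le_mul N c a
    rw [ha', mul_zero] at h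
    exact le_antisymm h (apply_nonneg N _)

lemma RingSeminorm.mem_nullIdeal {a : A} : a ∈ N.nullIdeal ↔ N a = 0 := Iff.rfl

end Seminorm

section CoeffSeminorm

open MvPolynomial

variable {s : ℕ}

/-- The sum of the absolute values of the coefficients of the monomials dividing a given one. -/
noncomputable def coeffSeminorm (M : Fin s →₀ ℕ) : RingSeminorm (MvPolynomial (Fin s) ℝ) where
  toFun f := ∑ β ∈ Finset.Icc 0 M, |coeff β f|
  map_zero' := by simp
  add_le' f g := by
    rw [← Finset.sum_add_distrib]
    refine Finset.sum_le_sum fun β _ => ?_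
    rw [coeff_add]
    exact abs_add_le _ _
  neg' f := by simp
  mul_le' f g := by
    calc ∑ β ∈ Finset.Icc 0 M, |coeff β (f * g)|
        ≤ ∑ β ∈ Finset.Icc 0 M,
            ∑ x ∈ Finset.HasAntidiagonal.antidiagonal β, |coeff x.1 f| * |coeff x.2 g| := by
          refine Finset.sum_le_sum fun β _ => ?_
          rw [coeff_mul]
          refine (Finset.abs_sum_le_sum_abs _ _).trans (le_of_eq ?_)
          simp_rw [abs_mul]
      _ = ∑ x ∈ (Finset.Icc 0 M).biUnion Finset.HasAntidiagonal.antidiagonal,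
            |coeff x.1 f| * |coeff x.2 g| := by
          rw [Finset.sum_biUnion]
          intro a _ b _ hab
          rw [Function.onFun, Finset.disjoint_left]
          intro x hx hx'
          rw [Finset.HasAntidiagonal.mem_antidiagonal] at hx hx'
          exact hab (hx.symm.trans hx')
      _ ≤ ∑ x ∈ Finset.Icc 0 M ×ˢ Finset.Icc 0 M, |coeff x.1 f| * |coeff x.2 g| := by
          refine Finset.sum_le_sum_of_subset_of_nonneg ?_ fun _ _ _ => by positivity
          intro x hx
          simp only [Finset.mem_biUnion, Finset.mem_Icc, Finset.HasAntidiagonal.mem_antidiagonal,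
            Finset.mem_product, zero_le, true_and] at hx ⊢
          obtain ⟨β, hβ, rfl⟩ := hx
          exact ⟨le_self_add.trans hβ, le_add_self.trans hβ⟩
      _ = _ := by rw [Finset.sum_mul_sum, Finset.sum_product]

variable (M : Fin s →₀ ℕ)

lemma coeffSeminorm_apply (f : MvPolynomial (Fin s) ℝ) :
    coeffSeminorm M f = ∑ β ∈ Finset.Icc 0 M, |coeff β f| := rfl

lemma coeffSeminorm_eq_zero_iff {f : MvPolynomial (Fin s) ℝ} :
    coeffSeminorm M f = 0 ↔ ∀ β ≤ M, coeff β f = 0 := by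
  rw [coeffSeminorm_apply, Finset.sum_eq_zero_iff_of_nonneg fun _ _ => abs_nonneg _]
  simp

lemma coeffSeminorm_monomial_le (α : Fin s →₀ ℕ) (a : ℝ) :
    coeffSeminorm M (monomial α a) ≤ |a| := by
  rw [coeffSeminorm_apply]
  have : ∀ β, |coeff β (monomial α a)| = if α = β then |a| else 0 := by
    intro β
    rw [coeff_monomial]
    split_ifs <;> simp
  simp_rw [this, Finset.sum_ite_eq]
  split_ifs <;> simp

lemma coeffSeminorm_monomial_eq_zero {α : Fin s →₀ ℕ} (h : ¬ α ≤ M) (a : ℝ) :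
    coeffSeminorm M (monomial α a) = 0 := by
  rw [coeffSeminorm_eq_zero_iff]
  intro β hβ
  rw [coeff_monomial, if_neg]
  rintro rfl
  exact h hβ

lemma coeffSeminorm_one_le : coeffSeminorm M 1 ≤ 1 := by
  simpa using coeffSeminorm_monomial_le M 0 1

lemma abs_coeff_mul_le {f g : MvPolynomial (Fin s) ℝ} {K : ℝ} (hK : ∀ β ≤ M, |coeff β g| ≤ K) :
    |coeff M (f * g)| ≤ coeffSeminorm M f * K := by
  rw [coeff_mul, coeffSeminorm_apply, Finset.sum_mul]
  refine (Finset.abs_sum_le_sum_abs _ _).trans ?_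
  calc ∑ x ∈ Finset.HasAntidiagonal.antidiagonal M, |coeff x.1 f * coeff x.2 g|
      ≤ ∑ x ∈ Finset.HasAntidiagonal.antidiagonal M, |coeff x.1 f| * K := by
        refine Finset.sum_le_sum fun x hx => ?_
        rw [Finset.HasAntidiagonal.mem_antidiagonal] at hx
        rw [abs_mul]
        gcongr
        exact hK _ (le_add_self.trans hx.le)
    _ = ∑ β ∈ (Finset.HasAntidiagonal.antidiagonal M).image Prod.fst, |coeff β f| * K := by
        rw [Finset.sum_image]
        intro x hx y hy h
        rw [Finset.mem_coe, Finset.HasAntidiagonal.mem_antidiagonal] at hx hy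
        refine Prod.ext h ?_
        rw [← hy, h] at hx
        exact add_left_cancel hx
    _ ≤ _ := by
        refine Finset.sum_le_sum_of_subset_of_nonneg ?_ fun _ _ _ => ?_
        · intro β hβ
          simp only [Finset.mem_image, Finset.HasAntidiagonal.mem_antidiagonal,
            Finset.mem_Icc, zero_le, true_and] at hβ ⊢
          obtain ⟨x, hx, rfl⟩ := hβ
          exact le_self_add.trans hx.le
        · exact mul_nonneg (abs_nonneg _) ((abs_nonneg _).trans (hK 0 zero_le))

end CoeffSeminorm

section Comparison

open MvPolynomial

variable {s : ℕ}

/-- One more than the maximal value of a multiplicity attached to the subset `I`. -/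
def multiplicityBound (m : ℕ) (I : Finset (Fin s)) : ℕ :=
  if I = ∅ then 1 else if Even I.card then m + 1 else 2

/-- The polynomial whose coefficients count, with signs, the families of multiplicities. -/
noncomputable def multiplicityPoly (s m : ℕ) : MvPolynomial (Fin s) ℝ :=
  ∏ I : Finset (Fin s), ∑ r ∈ Finset.range (multiplicityBound m I),
    monomial (indicatorExponent I) ((-1 : ℝ) ^ I.card) ^ r

/-- A polynomial congruent to `1 - y` or its inverse, according to the parity of `I`,
for `y` a monomial supported on `I`. -/
noncomputable def inverseFactor (d m : ℕ) (w : ℝ) (I : Finset (Fin s)) :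
    MvPolynomial (Fin s) ℝ :=
  if Even I.card then 1 - monomial (d • indicatorExponent I) w
  else ∑ r ∈ Finset.range (m + 1), monomial (d • indicatorExponent I) w ^ r

lemma not_smul_indicatorExponent_le {I : Finset (Fin s)} (hI : I ≠ ∅) {m e : ℕ} (he : m < e) :
    ¬ e • indicatorExponent I ≤ constExponent s m := by
  obtain ⟨i, hi⟩ := Finset.nonempty_iff_ne_empty.2 hI
  intro h
  have := h i
  simp [hi] at this
  omega

lemma coeffSeminorm_inverseFactor_le {d m : ℕ} (hm : 1 ≤ m) {w : ℝ} (h0 : 0 ≤ w) (hw : w ≤ 1 / 2)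
    (M : Fin s →₀ ℕ) (I : Finset (Fin s)) :
    coeffSeminorm M (inverseFactor d m w I - 1 +
      (-1) ^ I.card * monomial (d • indicatorExponent I) w) ≤ 2 * w ^ 2 := by
  rw [inverseFactor]
  have hy := coeffSeminorm_monomial_le M (d • indicatorExponent I) w
  rw [abs_of_nonneg h0] at hy
  set y := monomial (d • indicatorExponent I) w
  have hn : 0 ≤ coeffSeminorm M y := apply_nonneg _ _
  split_ifs with h
  · have : 1 - y - 1 + (-1) ^ I.card * y = 0 := by rw [h.neg_one_pow]; ring
    rw [this, map_zero]
    positivity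
  · rw [Nat.not_even_iff_odd] at h
    obtain ⟨m, rfl⟩ := Nat.exists_eq_add_of_le' hm
    have : ∑ r ∈ Finset.range (m + 1 + 1), y ^ r - 1 + (-1) ^ I.card * y =
        y * y * ∑ r ∈ Finset.range m, y ^ r := by
      rw [h.neg_one_pow, Finset.sum_range_succ', Finset.sum_range_succ', Finset.mul_sum]
      simp_rw [pow_succ']
      simp only [pow_zero, ← mul_assoc]
      ring
    rw [this]
    calc _ ≤ coeffSeminorm M y * coeffSeminorm M y *
          coeffSeminorm M (∑ r ∈ Finset.range m, y ^ r) :=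
          (map_mul_le_mul _ _ _).trans (by gcongr; exact map_mul_le_mul _ _ _)
      _ ≤ w * w * 2 := by
          gcongr
          exact RingSeminorm.map_geom_sum_le _ (coeffSeminorm_one_le M) (hy.trans hw) m
      _ = 2 * w ^ 2 := by ring

lemma coeffSeminorm_eulerFactor_le {d m : ℕ} (hm : 1 ≤ m) {w : ℝ} (h0 : 0 ≤ w)
    (hw : w ≤ 1 / 2) (M : Fin s →₀ ℕ) {t : Finset (Finset (Fin s))}
    (ht : t = Finset.univ.erase ∅) :
    coeffSeminorm M ((1 + C w * (∏ i : Fin s, (1 - X i ^ d) - 1)) *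
      ∏ I ∈ t, inverseFactor d m w I - 1) ≤
      ((t.card : ℝ) ^ 2 + (1 + t.card) * 10 ^ t.card) * w ^ 2 := by
  have e : C w * (∏ i : Fin s, (1 - X i ^ d) - 1) =
      ∑ I ∈ t, (-1) ^ I.card * monomial (d • indicatorExponent I) w := by
    rw [prod_one_sub_X_pow, ht, ← Finset.add_sum_erase _ _ (Finset.mem_univ ∅)]
    have : d • indicatorExponent (∅ : Finset (Fin s)) = 0 := by ext; simp
    rw [this, Finset.card_empty, pow_zero, one_mul, monomial_zero', C_1, add_sub_cancel_left,
      Finset.mul_sum]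
    refine Finset.sum_congr rfl fun I _ => ?_
    rw [mul_left_comm, C_mul_monomial, mul_one]
  rw [e]
  refine RingSeminorm.map_one_add_sum_mul_prod_sub_one_le _ t _ _ (coeffSeminorm_one_le M) h0 hw
    (fun I _ => ?_) fun I _ => coeffSeminorm_inverseFactor_le hm h0 hw M I
  have hy := coeffSeminorm_monomial_le M (d • indicatorExponent I) w
  rw [abs_of_nonneg h0] at hy
  rcases neg_one_pow_eq_or (MvPolynomial (Fin s) ℝ) I.card with h | h
  · rwa [h, one_mul]
  · rwa [h, neg_one_mul, map_neg_eq_map]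

lemma mk_pow_monomial_eq_zero {m : ℕ} {I : Finset (Fin s)} (hI : I ≠ ∅) {d : ℕ} (hd : 1 ≤ d)
    (w : ℝ) : Ideal.Quotient.mk (coeffSeminorm (constExponent s m)).nullIdeal
      (monomial (d • indicatorExponent I) w ^ (m + 1)) = 0 := by
  rw [Ideal.Quotient.eq_zero_iff_mem, RingSeminorm.mem_nullIdeal, monomial_pow, smul_smul]
  refine coeffSeminorm_monomial_eq_zero _ (not_smul_indicatorExponent_le hI ?_) _
  nlinarith

lemma mk_prod_one_sub_monomial (F : Type*) [Field F] [Fintype F] {m : ℕ} {I : Finset (Fin s)}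
    (hI : I ≠ ∅) :
    Ideal.Quotient.mk (coeffSeminorm (constExponent s m)).nullIdeal
      (∏ P ∈ monicIrreducibles F m, (1 - monomial (P.natDegree • indicatorExponent I)
        ((Fintype.card F : ℝ) ^ P.natDegree)⁻¹)) =
    Ideal.Quotient.mk (coeffSeminorm (constExponent s m)).nullIdeal
      (1 - monomial (indicatorExponent I) 1) := by
  rw [Ideal.Quotient.mk_eq_mk_iff_sub_mem, RingSeminorm.mem_nullIdeal, coeffSeminorm_eq_zero_iff]
  intro β hβ
  rw [coeff_sub, coeff_prod_one_sub_monomial F _ hβ, sub_self]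
  intro h
  obtain ⟨i, hi⟩ := Finset.nonempty_iff_ne_empty.2 hI
  have := DFunLike.congr_fun h i
  simp [hi] at this

lemma mk_sum_mul_prod_inverseFactor (F : Type*) [Field F] [Fintype F] {m : ℕ}
    {I : Finset (Fin s)} (hI : I ≠ ∅) :
    Ideal.Quotient.mk (coeffSeminorm (constExponent s m)).nullIdeal
      ((∏ P ∈ monicIrreducibles F m,
        inverseFactor P.natDegree m ((Fintype.card F : ℝ) ^ P.natDegree)⁻¹ I) *
        ∑ r ∈ Finset.range (multiplicityBound m I),
          monomial (indicatorExponent I) ((-1 : ℝ) ^ I.card) ^ r) = 1 := by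
  have hE := mk_prod_one_sub_monomial F (m := m) hI
  rw [multiplicityBound, if_neg hI]
  simp only [inverseFactor]
  split_ifs with h
  · rw [map_mul, hE, ← map_mul, h.neg_one_pow, mul_neg_geom_sum, map_sub, map_one]
    have := mk_pow_monomial_eq_zero (m := m) hI le_rfl 1
    rw [one_smul] at this
    rw [this, sub_zero]
  · rw [Nat.not_even_iff_odd] at h
    have e : ∑ r ∈ Finset.range 2, monomial (indicatorExponent I) ((-1 : ℝ) ^ I.card) ^ r =
        1 - monomial (indicatorExponent I) 1 := by
      rw [h.neg_one_pow, map_neg]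
      simp [Finset.sum_range_succ, sub_eq_add_neg]
    rw [e, map_mul, ← hE, ← map_mul, ← Finset.prod_mul_distrib, map_prod]
    refine Finset.prod_eq_one fun P hP => ?_
    rw [geom_sum_mul_neg, map_sub, map_one, mk_pow_monomial_eq_zero hI, sub_zero]
    exact (mem_monicIrreducibles.1 hP).2.1.natDegree_pos

lemma abs_coeff_prod_sub_coeff_multiplicityPoly_le (F : Type*) [Field F] [Fintype F] {m : ℕ}
    (hm : 1 ≤ m) {t : Finset (Finset (Fin s))} (ht : t = Finset.univ.erase ∅) {K : ℝ}
    (hK : ∀ β ≤ constExponent s m, |coeff β (multiplicityPoly s m)| ≤ K) {B : ℝ}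
    (hB : B = (t.card : ℝ) ^ 2 + (1 + t.card) * 10 ^ t.card) :
    |coeff (constExponent s m) (∏ P ∈ monicIrreducibles F m,
      (1 + C ((Fintype.card F : ℝ) ^ P.natDegree)⁻¹ *
        (∏ i : Fin s, (1 - X i ^ P.natDegree) - 1))) -
      coeff (constExponent s m) (multiplicityPoly s m)| ≤
      2 * B * Real.exp B / Fintype.card F * K := by
  set M := constExponent s m with hM
  set S := monicIrreducibles F m
  set x : Polynomial F → MvPolynomial (Fin s) ℝ := fun P =>
    1 + C ((Fintype.card F : ℝ) ^ P.natDegree)⁻¹ * (∏ i : Fin s, (1 - X i ^ P.natDegree) - 1)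
  set v : Polynomial F → Finset (Fin s) → MvPolynomial (Fin s) ℝ := fun P =>
    inverseFactor P.natDegree m ((Fintype.card F : ℝ) ^ P.natDegree)⁻¹
  set G := ∏ P ∈ S, (x P * ∏ I ∈ t, v P I)
  have hq : (2 : ℝ) ≤ Fintype.card F := by exact_mod_cast Fintype.one_lt_card
  have hB0 : 0 ≤ B := by rw [hB]; positivity
  have hK0 : 0 ≤ K := (abs_nonneg _).trans (hK 0 (zero_le))
  have hG : coeffSeminorm M (G - 1) ≤ 2 * B * Real.exp B / Fintype.card F := by
    have h1 : coeffSeminorm M (G - 1) ≤ Real.exp (B * (2 / Fintype.card F)) - 1 := by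
      have e : G = ∏ P ∈ S, (1 + (x P * ∏ I ∈ t, v P I - 1)) :=
        Finset.prod_congr rfl fun P _ => by ring
      rw [e]
      refine (RingSeminorm.map_prod_one_add_sub_one_le _ S _ (coeffSeminorm_one_le M)).trans ?_
      gcongr
      calc _ ≤ ∏ P ∈ S, Real.exp (B * (((Fintype.card F : ℝ) ^ P.natDegree)⁻¹) ^ 2) := by
            refine Finset.prod_le_prod (fun P _ => add_nonneg zero_le_one (apply_nonneg _ _))
              fun P hP => ?_
            rw [add_comm]
            refine le_trans ?_ (Real.add_one_le_exp _)
            gcongr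
            rw [hB]
            refine coeffSeminorm_eulerFactor_le hm (by positivity) ?_ M ht
            have hd := (mem_monicIrreducibles.1 hP).2.1.natDegree_pos
            rw [one_div]
            refine inv_anti₀ (by norm_num) (hq.trans ?_)
            exact le_self_pow₀ (by linarith) hd.ne'
        _ = Real.exp (B * ∑ P ∈ S, (((Fintype.card F : ℝ) ^ P.natDegree)⁻¹) ^ 2) := by
            rw [← Real.exp_sum, Finset.mul_sum]
        _ ≤ _ := by
            gcongr
            exact sum_monicIrreducibles_inv_sq_le F m
    refine h1.trans ?_
    set u := B * (2 / (Fintype.card F : ℝ)) with hu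
    have hu0 : 0 ≤ u := by positivity
    have huB : u ≤ B := by
      rw [hu]
      refine mul_le_of_le_one_right hB0 ?_
      rw [div_le_one (by linarith)]
      exact hq
    have h2 : Real.exp u - 1 ≤ u * Real.exp u := by
      have h3 := Real.add_one_le_exp (-u)
      have h4 : Real.exp u * Real.exp (-u) = 1 := by rw [← Real.exp_add]; simp
      nlinarith [Real.exp_pos u]
    calc _ ≤ u * Real.exp u := h2
      _ ≤ u * Real.exp B := by gcongr
      _ = _ := by rw [hu]; ring
  have hGH : ∀ β ≤ M, coeff β (∏ P ∈ S, x P) = coeff β (G * multiplicityPoly s m) := by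
    suffices h : Ideal.Quotient.mk (coeffSeminorm M).nullIdeal (G * multiplicityPoly s m) =
        Ideal.Quotient.mk (coeffSeminorm M).nullIdeal (∏ P ∈ S, x P) by
      rw [Ideal.Quotient.mk_eq_mk_iff_sub_mem, RingSeminorm.mem_nullIdeal,
        coeffSeminorm_eq_zero_iff] at h
      intro β hβ
      have := h β hβ
      rw [coeff_sub] at this
      linarith
    have e : G * multiplicityPoly s m = (∏ P ∈ S, x P) * ∏ I ∈ t, ((∏ P ∈ S, v P I) *
        ∑ r ∈ Finset.range (multiplicityBound m I),
          monomial (indicatorExponent I) ((-1 : ℝ) ^ I.card) ^ r) := by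
      rw [Finset.prod_mul_distrib, Finset.prod_comm, ← mul_assoc, ← Finset.prod_mul_distrib,
        multiplicityPoly, ← Finset.mul_prod_erase _ _ (Finset.mem_univ ∅), ← ht]
      simp [multiplicityBound, G]
    rw [e, map_mul, map_prod _ _ t, Finset.prod_eq_one (s := t), mul_one]
    intro I hI
    exact mk_sum_mul_prod_inverseFactor F (by simpa [ht] using hI)
  rw [hGH M le_rfl, ← coeff_sub]
  have e : G * multiplicityPoly s m - multiplicityPoly s m = (G - 1) * multiplicityPoly s m := by
    ring
  rw [e]
  exact (abs_coeff_mul_le M hK).trans (by gcongr)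

end Comparison

section MultiplicityFamilies

open MvPolynomial

variable {s : ℕ}

/-- The families of multiplicities, bounded by `multiplicityBound m`, with prescribed sums. -/
noncomputable def multiplicityFamilies (m : ℕ) (β : Fin s → ℕ) : Finset (Finset (Fin s) → ℕ) :=
  (Fintype.piFinset fun I => Finset.range (multiplicityBound m I)).filter fun r =>
    ∀ i, ∑ I ∈ Finset.univ.filter (fun I : Finset (Fin s) => i ∈ I), r I = β i

lemma mem_multiplicityFamilies {m : ℕ} {β : Fin s → ℕ} {r : Finset (Fin s) → ℕ} :
    r ∈ multiplicityFamilies m β ↔ (∀ I, r I < multiplicityBound m I) ∧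
      ∀ i, ∑ I ∈ Finset.univ.filter (fun I : Finset (Fin s) => i ∈ I), r I = β i := by
  simp [multiplicityFamilies]

lemma coeff_multiplicityPoly (m : ℕ) (β : Fin s →₀ ℕ) :
    coeff β (multiplicityPoly s m) =
      ∑ r ∈ multiplicityFamilies m β, ∏ I : Finset (Fin s), ((-1 : ℝ) ^ I.card) ^ r I := by
  rw [multiplicityPoly, Finset.prod_univ_sum, coeff_sum, multiplicityFamilies, Finset.sum_filter]
  refine Finset.sum_congr rfl fun r _ => ?_
  simp_rw [monomial_pow]
  rw [← monomial_sum_prod, coeff_monomial]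
  congr 1
  rw [eq_iff_iff, DFunLike.ext_iff]
  refine forall_congr' fun i => ?_
  simp [Finset.sum_filter, Finsupp.finsetSum_apply]

lemma abs_coeff_multiplicityPoly_le (m : ℕ) (β : Fin s →₀ ℕ) :
    |coeff β (multiplicityPoly s m)| ≤ (multiplicityFamilies m β).card := by
  rw [coeff_multiplicityPoly]
  refine (Finset.abs_sum_le_sum_abs _ _).trans (le_of_eq ?_)
  simp [Finset.abs_prod, abs_pow]

lemma sum_card_mul_eq {m : ℕ} {β : Fin s → ℕ} {r : Finset (Fin s) → ℕ}
    (hr : r ∈ multiplicityFamilies m β) : ∑ I, I.card * r I = ∑ i, β i := by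
  simp_rw [← (mem_multiplicityFamilies.1 hr).2, Finset.sum_filter]
  rw [Finset.sum_comm]
  refine Finset.sum_congr rfl fun I _ => ?_
  simp

lemma mem_multiplicityFamilies_const {m : ℕ} {r : Finset (Fin s) → ℕ} :
    r ∈ multiplicityFamilies m (constExponent s m) ↔ r ∅ = 0 ∧ (∀ I, Odd I.card → r I ≤ 1) ∧
      ∀ i, ∑ I ∈ Finset.univ.filter (fun I : Finset (Fin s) => i ∈ I), r I = m := by
  rw [mem_multiplicityFamilies]
  constructor
  · rintro ⟨h1, h2⟩
    refine ⟨by simpa [multiplicityBound] using h1 ∅, fun I hI => ?_, h2⟩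
    have h3 := h1 I
    rw [multiplicityBound, if_neg, if_neg (Nat.not_even_iff_odd.2 hI)] at h3
    · omega
    · rintro rfl
      simp at hI
  · rintro ⟨h1, h2, h3⟩
    refine ⟨fun I => ?_, h3⟩
    rw [multiplicityBound]
    split_ifs with hI hE
    · rw [hI, h1]; exact one_pos
    · obtain ⟨i, hi⟩ := Finset.nonempty_iff_ne_empty.2 hI
      rw [Nat.lt_succ_iff, ← h3 i]
      exact Finset.single_le_sum (f := r) (fun _ _ => Nat.zero_le _) (by simpa using hi)
    · exact Nat.lt_succ_of_le (h2 I (Nat.not_even_iff_odd.1 hE))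

lemma permTupleCount_eq_card (m k : ℕ) :
    permTupleCount m k = (multiplicityFamilies m (constExponent (2 * k) m)).card :=
  Nat.subtype_card _ fun _ => mem_multiplicityFamilies_const

lemma coeff_constExponent_multiplicityPoly (m k : ℕ) :
    coeff (constExponent (2 * k) m) (multiplicityPoly (2 * k) m) = permTupleCount m k := by
  rw [coeff_multiplicityPoly]
  have h : ∀ r ∈ multiplicityFamilies m (constExponent (2 * k) m),
      ∏ I : Finset (Fin (2 * k)), ((-1 : ℝ) ^ I.card) ^ r I = 1 := by
    intro r hr
    simp_rw [← pow_mul]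
    rw [Finset.prod_pow_eq_pow_sum, sum_card_mul_eq hr]
    refine Even.neg_one_pow ?_
    simp [mul_assoc]
  rw [Finset.sum_congr rfl h, Finset.sum_const, nsmul_eq_mul, mul_one,
    permTupleCount_eq_card]

/-- The nonempty subsets of even cardinality. -/
noncomputable def evenSubsets (s : ℕ) : Finset (Finset (Fin s)) :=
  Finset.univ.filter fun I => I ≠ ∅ ∧ Even I.card

lemma mem_evenSubsets {I : Finset (Fin s)} : I ∈ evenSubsets s ↔ I ≠ ∅ ∧ Even I.card := by
  simp [evenSubsets]

lemma card_evenSubsets (hs : 1 ≤ s) : (evenSubsets s).card = 2 ^ (s - 1) - 1 := by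
  have h1 : evenSubsets s = (Finset.univ.filter fun I : Finset (Fin s) => Even I.card).erase ∅ := by
    ext I
    simp [mem_evenSubsets]
  rw [h1, Finset.card_erase_of_mem (by simp)]
  congr 1
  have h2 : ∑ I : Finset (Fin s), (-1 : ℤ) ^ I.card = 0 := by
    rw [← Finset.powerset_univ]
    refine Finset.sum_powerset_neg_one_pow_card_of_nonempty ⟨⟨0, hs⟩, Finset.mem_univ _⟩
  have h3 : ∑ I : Finset (Fin s), (1 : ℤ) = 2 ^ s := by simp
  have h4 : ∀ I : Finset (Fin s), (1 : ℤ) + (-1) ^ I.card = if Even I.card then 2 else 0 := by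
    intro I
    split_ifs with h
    · rw [h.neg_one_pow]; norm_num
    · rw [(Nat.not_even_iff_odd.1 h).neg_one_pow]; norm_num
  have h5 : ∑ I : Finset (Fin s), ((1 : ℤ) + (-1) ^ I.card) = 2 ^ s := by
    rw [Finset.sum_add_distrib, h2, h3, add_zero]
  simp_rw [h4] at h5
  rw [← Finset.sum_filter, Finset.sum_const, nsmul_eq_mul] at h5
  obtain ⟨s, rfl⟩ := Nat.exists_eq_add_of_le' hs
  rw [pow_succ] at h5
  have := mul_right_cancel₀ two_ne_zero h5
  exact_mod_cast this

lemma card_multiplicityFamilies_le (m : ℕ) (β : Fin s → ℕ) {B : Finset (Finset (Fin s))}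
    (hB : B ⊆ evenSubsets s)
    (hinj : ∀ g : Finset (Fin s) → ℤ, (∀ I ∉ B, g I = 0) →
      (∀ i, ∑ I ∈ Finset.univ.filter (fun I : Finset (Fin s) => i ∈ I), g I = 0) → g = 0) :
    (multiplicityFamilies m β).card ≤ 2 ^ 2 ^ s * (m + 1) ^ ((evenSubsets s).card - B.card) := by
  have h1 : (multiplicityFamilies m β).card ≤
      (Fintype.piFinset fun I => Finset.range
        (if I ∈ B then 1 else multiplicityBound m I)).card := by
    refine Finset.card_le_card_of_injOn (fun r I => if I ∈ B then 0 else r I) ?_ ?_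
    · intro r hr
      have hr' := (mem_multiplicityFamilies.1 hr).1
      simp only [Finset.mem_coe, Fintype.mem_piFinset, Finset.mem_range]
      intro I
      split_ifs
      · exact one_pos
      · exact hr' I
    · intro r hr r' hr' h
      have h0 := hinj (fun I => (r I : ℤ) - r' I) ?_ ?_
      · funext I
        have := congr_fun h0 I
        simp only [Pi.zero_apply] at this
        omega
      · intro I hI
        have := congr_fun h I
        simp only [if_neg hI] at this
        rw [this, sub_self]
      · intro i
        rw [Finset.sum_sub_distrib, sub_eq_zero]
        have e := (mem_multiplicityFamilies.1 hr).2 i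
        rw [← (mem_multiplicityFamilies.1 hr').2 i] at e
        exact_mod_cast e
  refine h1.trans ?_
  rw [Fintype.card_piFinset]
  simp only [Finset.card_range]
  calc ∏ I : Finset (Fin s), (if I ∈ B then 1 else multiplicityBound m I)
      ≤ ∏ I : Finset (Fin s), (2 * if I ∈ evenSubsets s \ B then m + 1 else 1) := by
        refine Finset.prod_le_prod' fun I _ => ?_
        rw [multiplicityBound]
        simp only [Finset.mem_sdiff, mem_evenSubsets]
        split_ifs <;> grind
    _ = _ := by
        rw [Finset.prod_mul_distrib, Finset.prod_ite_mem, Finset.univ_inter, Finset.prod_const,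
          Finset.prod_const, Finset.card_sdiff_of_subset hB]
        simp

lemma exists_subset_evenSubsets {k : ℕ} (hk : 1 ≤ k) :
    ∃ B ⊆ evenSubsets (2 * k), (evenSubsets (2 * k)).card - B.card = 2 ^ (2 * k - 1) - 1 - 2 * k ∧
      ∀ g : Finset (Fin (2 * k)) → ℤ, (∀ I ∉ B, g I = 0) →
        (∀ i, ∑ I ∈ Finset.univ.filter (fun I : Finset (Fin (2 * k)) => i ∈ I), g I = 0) →
        g = 0 := by
  rw [card_evenSubsets (by omega)]
  rcases hk.eq_or_lt with rfl | hk
  · refine ⟨{Finset.univ}, ?_, by simp, ?_⟩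
    · rw [Finset.singleton_subset_iff, mem_evenSubsets]
      exact ⟨Finset.univ_nonempty.ne_empty, by simp⟩
    · intro g hg h
      have h0 := h 0
      rw [Finset.sum_eq_single Finset.univ (fun I _ hI => hg I (by simpa using hI))
        (by simp)] at h0
      funext I
      by_cases hI : I = Finset.univ
      · rw [hI, h0]; rfl
      · exact hg I (by simpa using hI)
  · obtain ⟨x, y, z, hxy, hxz, hyz⟩ : ∃ x y z : Fin (2 * k), x ≠ y ∧ x ≠ z ∧ y ≠ z :=
      ⟨⟨0, by omega⟩, ⟨1, by omega⟩, ⟨2, by omega⟩, by simp, by simp, by simp⟩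
    set b : Fin (2 * k) → Finset (Fin (2 * k)) := fun j => if j = x then {y, z} else {x, j}
    have hb : ∀ i j, i ∈ b j ↔ if j = x then i = y ∨ i = z else i = x ∨ i = j := by
      intro i j
      simp only [b]
      split_ifs <;> simp
    have hbi : Function.Injective b := by
      intro j j' h
      have h1 := hb j j
      have h2 := hb j j'
      have h3 := hb x j
      have h4 := hb x j'
      rw [h] at h1 h3
      grind
    refine ⟨Finset.univ.image b, ?_, ?_, ?_⟩
    · intro I hI
      obtain ⟨j, -, rfl⟩ := Finset.mem_image.1 hI
      rw [mem_evenSubsets]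
      have : (b j).card = 2 := by
        simp only [b]
        split_ifs with h
        · exact Finset.card_pair hyz
        · exact Finset.card_pair (Ne.symm h)
      refine ⟨fun h => ?_, by rw [this]; exact even_two⟩
      simp [h] at this
    · rw [Finset.card_image_of_injective _ hbi]
      simp
    · intro g hg h
      have h' : ∀ i, ∑ j, (if i ∈ b j then g (b j) else 0) = 0 := by
        intro i
        refine Eq.trans ?_ (h i)
        rw [Finset.sum_filter,
          ← Finset.sum_image (s := Finset.univ) (g := b) (f := fun I => if i ∈ I then g I else 0)
            hbi.injOn]
        refine Finset.sum_subset (Finset.subset_univ _) fun I _ hI => ?_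
        rw [hg I hI, ite_self]
      have hne : ∀ i, i ≠ x → (if i = y ∨ i = z then g (b x) else 0) + g (b i) = 0 := by
        intro i hi
        refine Eq.trans ?_ (h' i)
        rw [← Finset.add_sum_erase _ _ (Finset.mem_univ x)]
        congr 1
        · simp [hb]
        · rw [Finset.sum_eq_single i]
          · rw [if_pos]
            simp [hb, hi]
          · intro j hj hji
            rw [if_neg]
            rw [hb, if_neg (Finset.ne_of_mem_erase hj)]
            tauto
          · simp [hi]
      have hx := h' x
      have hx' : ∑ j ∈ Finset.univ.erase x, g (b j) = 0 := by
        rw [← hx, ← Finset.add_sum_erase _ _ (Finset.mem_univ x), if_neg (by simp [hb, hxy, hxz]),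
          zero_add]
        refine Finset.sum_congr rfl fun j hj => ?_
        rw [if_pos]
        simp [hb, Finset.ne_of_mem_erase hj]
      have hg0 : g (b x) = 0 := by
        have e : ∑ j ∈ Finset.univ.erase x, g (b j) =
            ∑ j ∈ Finset.univ.erase x, (if j ∈ ({y, z} : Finset _) then - g (b x) else 0) := by
          refine Finset.sum_congr rfl fun j hj => ?_
          have := hne j (Finset.ne_of_mem_erase hj)
          simp only [Finset.mem_insert, Finset.mem_singleton]
          split_ifs at this ⊢ <;> linarith
        rw [hx', Finset.sum_ite_mem, Finset.inter_eq_right.2, Finset.sum_pair hyz] at e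
        · linarith
        · intro j
          simp only [Finset.mem_insert, Finset.mem_singleton, Finset.mem_erase, Finset.mem_univ,
            and_true]
          rintro (rfl | rfl)
          exacts [hxy.symm, hxz.symm]
      funext I
      by_cases hI : I ∈ Finset.univ.image b
      · obtain ⟨j, -, rfl⟩ := Finset.mem_image.1 hI
        by_cases hj : j = x
        · rw [hj, hg0]; rfl
        · have := hne j hj
          rw [hg0, ite_self, zero_add] at this
          exact this
      · exact hg I hI

end MultiplicityFamilies

section LowerBound

lemma card_fiber_le_permTupleCount {m k a : ℕ} (ha : (evenSubsets (2 * k)).card * a ≤ m)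
    (y : Fin (2 * k) → ℕ) :
    ((Fintype.piFinset fun I => Finset.range (if I ∈ evenSubsets (2 * k) then a + 1 else 1)).filter
      fun u : Finset (Fin (2 * k)) → ℕ =>
        (fun i => ∑ I ∈ Finset.univ.filter (fun I : Finset (Fin (2 * k)) => i ∈ I), u I) = y).card ≤
      permTupleCount m k := by
  set A := (Fintype.piFinset fun I => Finset.range
    (if I ∈ evenSubsets (2 * k) then a + 1 else 1)).filter
      fun u : Finset (Fin (2 * k)) → ℕ =>
        (fun i => ∑ I ∈ Finset.univ.filter (fun I : Finset (Fin (2 * k)) => i ∈ I), u I) = y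
    with hA
  have hmem : ∀ u ∈ A, (∀ I ∈ evenSubsets (2 * k), u I ≤ a) ∧
      (∀ I ∉ evenSubsets (2 * k), u I = 0) ∧
      ∀ i, ∑ I ∈ Finset.univ.filter (fun I : Finset (Fin (2 * k)) => i ∈ I), u I = y i := by
    intro u hu
    rw [hA, Finset.mem_filter, Fintype.mem_piFinset] at hu
    refine ⟨fun I hI => ?_, fun I hI => ?_, fun i => congr_fun hu.2 i⟩
    · have := hu.1 I
      rw [if_pos hI, Finset.mem_range] at this
      omega
    · have := hu.1 I
      rw [if_neg hI, Finset.mem_range] at this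
      omega
  rcases A.eq_empty_or_nonempty with h0 | ⟨v, hv⟩
  · simp [h0]
  obtain ⟨hv1, hv2, hv3⟩ := hmem v hv
  have hsum : ∑ I, v I ≤ m := by
    refine le_trans ?_ ha
    rw [← Finset.sum_subset (Finset.subset_univ (evenSubsets (2 * k))) fun I _ hI => hv2 I hI]
    exact Finset.sum_le_card_nsmul _ _ _ hv1
  have hcompl : ∀ i, ∑ I ∈ Finset.univ.filter (fun I : Finset (Fin (2 * k)) => i ∈ I), v Iᶜ =
      ∑ I ∈ Finset.univ.filter (fun I : Finset (Fin (2 * k)) => i ∉ I), v I := by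
    intro i
    refine Finset.sum_nbij' (fun I => Iᶜ) (fun I => Iᶜ) ?_ ?_ ?_ ?_ ?_ <;> simp
  have hparity : ∀ I : Finset (Fin (2 * k)), Odd I.card → Iᶜ ∉ evenSubsets (2 * k) := by
    intro I hI
    rw [mem_evenSubsets, Finset.card_compl, Fintype.card_fin]
    rintro ⟨-, h⟩
    have := Finset.card_le_univ I
    rw [Fintype.card_fin] at this
    rw [Nat.even_iff] at h
    rw [Nat.odd_iff] at hI
    omega
  rw [permTupleCount_eq_card]
  refine Finset.card_le_card_of_injOn (fun u I => if I = ∅ then 0 else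
    u I + (v Iᶜ + if I = Finset.univ then m - ∑ J, v J else 0)) ?_ ?_
  · intro u hu
    obtain ⟨-, hu2, hu3⟩ := hmem u hu
    rw [Finset.mem_coe, mem_multiplicityFamilies_const]
    refine ⟨if_pos rfl, fun I hI => ?_, fun i => ?_⟩
    · have h1 : I ∉ evenSubsets (2 * k) := fun h =>
        Nat.not_even_iff_odd.2 hI (mem_evenSubsets.1 h).2
      have h2 : I ≠ Finset.univ := by
        rintro rfl
        rw [Finset.card_univ, Fintype.card_fin] at hI
        exact Nat.not_even_iff_odd.2 hI (even_two_mul k)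
      simp [hu2 I h1, hv2 _ (hparity I hI), h2]
    · have h1 : ∀ I ∈ Finset.univ.filter (fun I : Finset (Fin (2 * k)) => i ∈ I),
          (if I = ∅ then 0 else u I + (v Iᶜ + if I = Finset.univ then m - ∑ J, v J else 0)) =
          u I + (v Iᶜ + if I = Finset.univ then m - ∑ J, v J else 0) := by
        intro I hI
        rw [if_neg]
        rintro rfl
        simp at hI
      rw [Finset.sum_congr rfl h1, Finset.sum_add_distrib, Finset.sum_add_distrib, hcompl, hu3,
        ← hv3, ← add_assoc, Finset.sum_filter_add_sum_filter_not, Finset.sum_ite_eq',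
        if_pos (by simp)]
      omega
  · intro u hu u' hu' h
    funext I
    by_cases hI : I = ∅
    · rw [(hmem u hu).2.1 I (by simp [hI, mem_evenSubsets]),
        (hmem u' hu').2.1 I (by simp [hI, mem_evenSubsets])]
    · have := congr_fun h I
      simp only [if_neg hI] at this
      exact Nat.add_right_cancel this

lemma pow_le_mul_permTupleCount (m k : ℕ) :
    (m / (evenSubsets (2 * k)).card + 1) ^ (evenSubsets (2 * k)).card ≤
      permTupleCount m k * ((evenSubsets (2 * k)).card *
        (m / (evenSubsets (2 * k)).card) + 1) ^ (2 * k) := by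
  set E := (evenSubsets (2 * k)).card with hE
  set a := m / E
  have h := Finset.card_le_mul_card_image_of_maps_to
    (s := Fintype.piFinset fun I => Finset.range (if I ∈ evenSubsets (2 * k) then a + 1 else 1))
    (t := Fintype.piFinset fun _ : Fin (2 * k) => Finset.range (E * a + 1))
    (f := fun (u : Finset (Fin (2 * k)) → ℕ) i =>
      ∑ I ∈ Finset.univ.filter (fun I : Finset (Fin (2 * k)) => i ∈ I), u I) ?_ _
    fun y _ => card_fiber_le_permTupleCount (Nat.mul_div_le m E) y
  · simpa [Fintype.card_piFinset, Finset.prod_ite_mem, hE] using h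
  · intro u hu
    rw [Fintype.mem_piFinset] at hu ⊢
    intro i
    rw [Finset.mem_range, Nat.lt_succ_iff]
    calc _ ≤ ∑ I, u I := Finset.sum_le_sum_of_subset (Finset.subset_univ _)
      _ = ∑ I ∈ evenSubsets (2 * k), u I := by
          refine (Finset.sum_subset (Finset.subset_univ _) fun I _ hI => ?_).symm
          have := hu I
          rw [if_neg hI, Finset.mem_range] at this
          omega
      _ ≤ _ := by
          refine Finset.sum_le_card_nsmul _ _ _ fun I hI => ?_
          have := hu I
          rw [if_pos hI, Finset.mem_range] at this
          omega

lemma succ_pow_le_mul_permTupleCount {k : ℕ} (hk : 1 ≤ k) :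
    ∃ L : ℕ, ∀ m, (m + 1) ^ (2 ^ (2 * k - 1) - 1 - 2 * k) ≤ L * permTupleCount m k := by
  have hcard := card_evenSubsets (s := 2 * k) (by omega)
  rw [← hcard]
  set E := (evenSubsets (2 * k)).card with hE
  have hE1 : 1 ≤ E := by
    rw [hcard]
    have : 2 ^ 1 ≤ 2 ^ (2 * k - 1) := Nat.pow_le_pow_right (by norm_num) (by omega)
    omega
  refine ⟨E ^ (E - 2 * k) * E ^ (2 * k), fun m => ?_⟩
  have h := pow_le_mul_permTupleCount m k
  rw [← hE] at h
  set a := m / E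
  have hm : m + 1 ≤ E * (a + 1) := Nat.lt_mul_div_succ m hE1
  have h1 : E * a + 1 ≤ E * (a + 1) := by rw [mul_add]; omega
  have h2 : (a + 1) ^ (E - 2 * k) ≤ permTupleCount m k * E ^ (2 * k) := by
    rcases le_total (2 * k) E with hkE | hkE
    · refine Nat.le_of_mul_le_mul_right (c := (a + 1) ^ (2 * k)) ?_ (by positivity)
      rw [← pow_add, Nat.sub_add_cancel hkE, mul_assoc, ← mul_pow]
      exact h.trans (by gcongr)
    · rw [Nat.sub_eq_zero_of_le hkE, pow_zero]
      have hc : permTupleCount m k ≠ 0 := by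
        intro h0
        rw [h0, zero_mul] at h
        exact absurd h (Nat.not_le.2 (by positivity))
      exact Nat.mul_pos (Nat.pos_of_ne_zero hc) (by positivity)
  calc _ ≤ (E * (a + 1)) ^ (E - 2 * k) := by gcongr
    _ = E ^ (E - 2 * k) * (a + 1) ^ (E - 2 * k) := mul_pow _ _ _
    _ ≤ E ^ (E - 2 * k) * (permTupleCount m k * E ^ (2 * k)) := by gcongr
    _ = _ := by ring

end LowerBound

lemma add_one_pow_le_and_one_add_zpow_le {k m : ℕ} (hk : 1 ≤ k) (hm : 1 ≤ m) :
    ((m : ℝ) + 1) ^ (2 ^ (2 * k - 1) - 1 - 2 * k) ≤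
      2 ^ (2 ^ (2 * k - 1) - 1 - 2 * k) *
        (1 + (m : ℝ) ^ ((2 : ℤ) ^ (2 * k - 1) - 2 * k - 1)) ∧
    1 + (m : ℝ) ^ ((2 : ℤ) ^ (2 * k - 1) - 2 * k - 1) ≤
      2 * ((m : ℝ) + 1) ^ (2 ^ (2 * k - 1) - 1 - 2 * k) := by
  have hm' : (1 : ℝ) ≤ m := by exact_mod_cast hm
  rcases hk.eq_or_lt with rfl | hk
  · have h1 : (m : ℝ) ^ ((2 : ℤ) ^ (2 * 1 - 1) - 2 * (1 : ℕ) - 1) = (m : ℝ)⁻¹ := by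
      norm_num
    rw [h1]
    have h2 : (m : ℝ)⁻¹ ≤ 1 := inv_le_one_of_one_le₀ hm'
    have h3 : 0 ≤ (m : ℝ)⁻¹ := by positivity
    norm_num
    linarith
  · have hD : 2 * k + 1 ≤ 2 ^ (2 * k - 1) := by
      obtain ⟨j, rfl⟩ := Nat.exists_eq_add_of_le' hk
      clear hk
      induction j with
      | zero => norm_num
      | succ j ih =>
        have e : 2 * (j + 1 + (1 + 1)) - 1 = (2 * (j + (1 + 1)) - 1) + 2 := by omega
        simp only [Nat.succ_eq_add_one] at ih ⊢
        rw [e, pow_add]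
        omega
    have h1 : (2 : ℤ) ^ (2 * k - 1) - 2 * k - 1 = ((2 ^ (2 * k - 1) - 1 - 2 * k : ℕ) : ℤ) := by
      rw [Nat.cast_sub (by omega), Nat.cast_sub (by omega)]
      push_cast
      ring
    rw [h1, zpow_natCast]
    generalize 2 ^ (2 * k - 1) - 1 - 2 * k = D
    constructor
    · calc ((m : ℝ) + 1) ^ D ≤ (2 * m) ^ D := by gcongr; linarith
        _ = 2 ^ D * (m : ℝ) ^ D := mul_pow _ _ _
        _ ≤ _ := by gcongr; linarith
    · have h2 : (m : ℝ) ^ D ≤ ((m : ℝ) + 1) ^ D := by gcongr; linarith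
      have h3 : (1 : ℝ) ≤ ((m : ℝ) + 1) ^ D := one_le_pow₀ (by linarith)
      linarith

/-- For each `k ≥ 1` there is a constant `C(k) > 0` such that for every finite field
`𝔽_q` (i.e. every prime power `q`) and all `m ≥ 1`, `n ≥ 2mk`, one has
`|Poly_q(n,m;k) − c(m,k)| ≤ C(k)·c(m,k)/q`; in particular, for `q ≥ 2C(k)`,
`Poly_q(n,m;k)` is bounded above and below by positive constants (depending only on
`k`) times `1 + m^{2^{2k−1}−2k−1}`. -/
theorem polyMoment_approx (k : ℕ) (hk : 1 ≤ k) :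
    ∃ C : ℝ, 0 < C ∧
      (∀ (Fq : Type) [Field Fq] [Fintype Fq],
        ∀ m n : ℕ, 1 ≤ m → 2 * m * k ≤ n →
          |polyMoment Fq n m k - (permTupleCount m k : ℝ)| ≤
            C * (permTupleCount m k : ℝ) / (Fintype.card Fq : ℝ)) ∧
      (∃ c₁ c₂ : ℝ, 0 < c₁ ∧ 0 < c₂ ∧
        ∀ (Fq : Type) [Field Fq] [Fintype Fq],
          ∀ m n : ℕ, 1 ≤ m → 2 * m * k ≤ n → 2 * C ≤ (Fintype.card Fq : ℝ) →
            c₁ * (1 + (m : ℝ) ^ ((2 : ℤ) ^ (2 * k - 1) - 2 * k - 1)) ≤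
              polyMoment Fq n m k ∧
            polyMoment Fq n m k ≤
              c₂ * (1 + (m : ℝ) ^ ((2 : ℤ) ^ (2 * k - 1) - 2 * k - 1))) := by
  obtain ⟨B, hB, hcard, hinj⟩ := exists_subset_evenSubsets hk
  obtain ⟨L, hL⟩ := succ_pow_le_mul_permTupleCount hk
  have hasymp := fun m => add_one_pow_le_and_one_add_zpow_le (m := m) hk
  have hup : ∀ m (β : Fin (2 * k) → ℕ), (multiplicityFamilies m β).card ≤
      2 ^ 2 ^ (2 * k) * (m + 1) ^ (2 ^ (2 * k - 1) - 1 - 2 * k) := fun m β => by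
    rw [← hcard]
    exact card_multiplicityFamilies_le m β hB hinj
  generalize 2 ^ (2 * k - 1) - 1 - 2 * k = D at *
  generalize 2 ^ 2 ^ (2 * k) = U at *
  obtain ⟨t, ht⟩ : ∃ t : Finset (Finset (Fin (2 * k))), t = Finset.univ.erase ∅ := ⟨_, rfl⟩
  obtain ⟨b, hb⟩ : ∃ b : ℝ, b = (t.card : ℝ) ^ 2 + (1 + t.card) * 10 ^ t.card := ⟨_, rfl⟩
  have hb0 : 0 ≤ b := by rw [hb]; positivity
  have hL0 : 0 < (L : ℝ) := by
    have h := hL 0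
    rw [zero_add, one_pow] at h
    exact_mod_cast Nat.pos_of_mul_pos_right h
  have hL' : ∀ m : ℕ, ((m : ℝ) + 1) ^ D ≤ L * permTupleCount m k := fun m => by
    exact_mod_cast hL m
  have hup' : ∀ m : ℕ, (permTupleCount m k : ℝ) ≤ U * ((m : ℝ) + 1) ^ D := fun m => by
    rw [permTupleCount_eq_card]
    exact_mod_cast hup m _
  have hmain : ∀ (Fq : Type) [Field Fq] [Fintype Fq], ∀ m n : ℕ, 1 ≤ m → 2 * m * k ≤ n →
      |polyMoment Fq n m k - (permTupleCount m k : ℝ)| ≤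
        (2 * b * Real.exp b * (U * L) + 1) * (permTupleCount m k : ℝ) /
          (Fintype.card Fq : ℝ) := by
    intro Fq _ _ m n hm hn
    rw [polyMoment_eq_coeff Fq hn, ← coeff_constExponent_multiplicityPoly]
    refine (abs_coeff_prod_sub_coeff_multiplicityPoly_le Fq hm ht
      (K := U * (L * permTupleCount m k)) (fun β _ => ?_) hb).trans ?_
    · refine (abs_coeff_multiplicityPoly_le m β).trans ?_
      calc ((multiplicityFamilies m β).card : ℝ) ≤ U * ((m : ℝ) + 1) ^ D := by
            exact_mod_cast hup m β
        _ ≤ _ := by gcongr; exact hL' m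
    · rw [coeff_constExponent_multiplicityPoly, div_mul_eq_mul_div]
      have : (0 : ℝ) ≤ permTupleCount m k := Nat.cast_nonneg _
      refine div_le_div_of_nonneg_right ?_ (Nat.cast_nonneg _)
      linarith
  have hC : 0 < 2 * b * Real.exp b * (U * L) + 1 := by positivity
  generalize 2 * b * Real.exp b * (U * L) + 1 = C at *
  refine ⟨C, hC, hmain, (4 * L)⁻¹, 3 / 2 * (U + 1) * 2 ^ D, by positivity, by positivity, ?_⟩
  intro Fq _ _ m n hm hn hq
  have h := hmain Fq m n hm hn
  have hq0 : 0 < (Fintype.card Fq : ℝ) := by exact_mod_cast Fintype.card_pos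
  have hc0 : (0 : ℝ) ≤ permTupleCount m k := Nat.cast_nonneg _
  have h2 : C * (permTupleCount m k : ℝ) / (Fintype.card Fq : ℝ) ≤ permTupleCount m k / 2 := by
    rw [div_le_div_iff₀ hq0 two_pos]
    nlinarith
  obtain ⟨h3, h4⟩ := abs_le.1 (h.trans h2)
  obtain ⟨h5, h6⟩ := hasymp m hm
  have h7 := hL' m
  have h8 := hup' m
  generalize (m : ℝ) ^ ((2 : ℤ) ^ (2 * k - 1) - 2 * k - 1) = x at *
  constructor
  · rw [inv_mul_le_iff₀ (by positivity)]
    calc 1 + x ≤ 2 * (L * permTupleCount m k) := h6.trans (by gcongr)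
      _ = 4 * L * (permTupleCount m k / 2) := by ring
      _ ≤ _ := by gcongr; linarith
  · calc polyMoment Fq n m k ≤ 3 / 2 * permTupleCount m k := by linarith
      _ ≤ 3 / 2 * (U * ((m : ℝ) + 1) ^ D) := by gcongr
      _ ≤ 3 / 2 * ((U + 1) * (2 ^ D * (1 + x))) := by gcongr; linarith
      _ = _ := by ring
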